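/- Let 𝒜 be a finite set of complex numbers and let b be a biinfinite sequence with entries in 𝒜. If for every 𝔞 ∈ 𝒜 the constant biinfinite sequence with all entries equal to 𝔞 belongs to X_b, the closure of the shift orbit of b, then closure(W(A_b)) = conv(⋃_{𝔞∈𝒜} closure(W(A_𝔞))) = conv(⋃_{𝔞∈𝒜} σ(A_𝔞)), where A_𝔞 denotes the Laurent operator corresponding to the constant sequence with all entries equal to 𝔞. -/

import Mathlib

open scoped ComplexConjugate ENNReal
open Filter

noncomputable section

/-- `ℓ²(ℤ)`, the Hilbert space of square-summable biinfinite complex sequences. -/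
abbrev Hseq : Type := lp (fun _ : ℤ => ℂ) 2

/-- `A` is the (bounded) tridiagonal operator `A_b` associated to the biinfinite
sequence `b`, i.e. `(A x) j = x (j+1) + b (j-1) * x (j-1)`. -/
def IsTridiag (b : ℤ → ℂ) (A : Hseq →L[ℂ] Hseq) : Prop :=
  ∀ x : Hseq, ∀ j : ℤ,
    (A x : ℤ → ℂ) j = (x : ℤ → ℂ) (j + 1) + b (j - 1) * (x : ℤ → ℂ) (j - 1)

/-- The numerical range `W(A) = {⟨Ax, x⟩ : ‖x‖ = 1}`, where
`⟨u, v⟩ = ∑ₖ uₖ · conj(vₖ)`; in Mathlib's convention this is `⟪x, A x⟫_ℂ`. -/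
def numRange (A : Hseq →L[ℂ] Hseq) : Set ℂ :=
  {z | ∃ x : Hseq, ‖x‖ = 1 ∧ (inner (𝕜 := ℂ) x (A x) : ℂ) = z}

/-- The shift orbit `Orb(b) = {φⁿ(b) : n ∈ ℤ}` where `(φⁿ(b))ᵢ = b_{i+n}`. -/
def shiftOrbit (b : ℤ → ℂ) : Set (ℤ → ℂ) :=
  {c | ∃ n : ℤ, c = fun i => b (i + n)}

/-- The symbol of the Laurent operator at the point `t`. -/
def symb (a t : ℂ) : ℂ := t + a * conj t

/-- The symbol curve. -/
def curve (a : ℂ) : Set ℂ := symb a '' Metric.sphere 0 1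

/-- The symbol as a real-linear map. -/
def symbL (a : ℂ) : ℂ →L[ℝ] ℂ :=
  ContinuousLinearMap.id ℝ ℂ + (ContinuousLinearMap.mul ℝ ℂ a).comp Complex.conjCLE.toContinuousLinearMap

lemma symbL_apply (a t : ℂ) : symbL a t = symb a t := by
  simp [symbL, symb]

lemma isCompact_hull_curve (a : ℂ) : IsCompact (convexHull ℝ (curve a)) := by
  have h : curve a = symbL a '' Metric.sphere 0 1 := by
    unfold curve; congr 1
  rw [h]
  have h2 := (symbL a).toLinearMap.image_convexHull (Metric.sphere (0:ℂ) 1)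
  rw [ContinuousLinearMap.coe_coe] at h2
  rw [← h2, convexHull_sphere_eq_closedBall _ zero_le_one]
  exact (isCompact_closedBall 0 1).image (symbL a).continuous

lemma isCompact_convexJoin {s t : Set ℂ} (hs : IsCompact s) (ht : IsCompact t) :
    IsCompact (convexJoin ℝ s t) := by
  have h : convexJoin ℝ s t =
      (fun p : ℝ × ℂ × ℂ => p.2.1 + p.1 • (p.2.2 - p.2.1)) '' (Set.Icc (0:ℝ) 1 ×ˢ s ×ˢ t) := by
    ext z
    simp only [mem_convexJoin, segment_eq_image', Set.mem_image, Set.mem_prod, Prod.exists]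
    constructor
    · rintro ⟨x, hx, y, hy, r, hr, rfl⟩
      exact ⟨r, x, y, ⟨hr, hx, hy⟩, rfl⟩
    · rintro ⟨r, x, y, ⟨hr, hx, hy⟩, rfl⟩
      exact ⟨x, hx, y, hy, r, hr, rfl⟩
  rw [h]
  exact (isCompact_Icc.prod (hs.prod ht)).image (by fun_prop)

lemma isCompact_hull_biUnion (S : ℂ → Set ℂ) (hS : ∀ a, IsCompact (convexHull ℝ (S a)))
    (s : Finset ℂ) : IsCompact (convexHull ℝ (⋃ a ∈ s, S a)) := by
  classical
  induction s using Finset.induction_on with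
  | empty => simp
  | insert a s ha ih =>
    rw [Finset.set_biUnion_insert]
    rcases (S a).eq_empty_or_nonempty with h | h
    · rw [h, Set.empty_union]; exact ih
    rcases (⋃ a ∈ s, S a).eq_empty_or_nonempty with h' | h'
    · rw [h', Set.union_empty]; exact hS a
    rw [convexHull_union h h']
    exact isCompact_convexJoin (hS a) ih

/-- Real functionals on `ℂ`. -/
lemma dual_eq (f : StrongDual ℝ ℂ) : ∃ w : ℂ, ∀ z, f z = (w * z).re := by
  refine ⟨⟨f 1, - f Complex.I⟩, fun z => ?_⟩
  conv_lhs => rw [← Complex.re_add_im z]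
  have h1 : (z.re : ℂ) = z.re • (1:ℂ) := by simp
  have h2 : (z.im : ℂ) * Complex.I = z.im • Complex.I := by simp
  rw [h1, h2, map_add, map_smul, map_smul]
  simp [Complex.mul_re]
  ring

lemma norm_le_of_curve (w a : ℂ) (c : ℝ) (h : ∀ z ∈ curve a, (w * z).re ≤ c) :
    ‖w + conj (w * a)‖ ≤ c := by
  set v := w + conj (w * a) with hv
  have key : ∀ t : ℂ, (w * symb a t).re = (v * t).re := by
    intro t
    simp [hv, symb, Complex.mul_re, Complex.mul_im]
    ring
  by_cases h0 : v = 0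
  · have := h _ ⟨1, by simp, rfl⟩
    rw [key, h0] at this
    simpa [h0] using this
  · have h1 : ‖v‖ ≠ 0 := norm_ne_zero_iff.mpr h0
    have := h _ ⟨conj v / ‖v‖, by simp [h1], rfl⟩
    rw [key, ← mul_div_assoc, Complex.mul_conj, Complex.normSq_eq_norm_sq] at this
    rw [← Complex.ofReal_div, Complex.ofReal_re] at this
    rwa [pow_two, mul_div_assoc, div_self h1, mul_one] at this

lemma summable_sq (x : Hseq) : HasSum (fun j : ℤ => ‖(x : ℤ → ℂ) j‖ ^ 2) (‖x‖ ^ 2) := by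
  have := lp.hasSum_norm (p := 2) (by norm_num) x
  simpa using this

lemma re_inner_le {b : ℤ → ℂ} {A : Hseq →L[ℂ] Hseq} (hA : IsTridiag b A) (w : ℂ) (c : ℝ)
    (hc : ∀ j, ‖w + conj (w * b j)‖ ≤ c) (x : Hseq) :
    (w * (inner ℂ x (A x) : ℂ)).re ≤ c * ‖x‖ ^ 2 := by
  have hs := summable_sq x
  have hs1 : HasSum (fun j : ℤ => ‖(x : ℤ → ℂ) (j + 1)‖ ^ 2) (‖x‖ ^ 2) :=
    (Equiv.addRight (1:ℤ)).hasSum_iff.mpr hs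
  have hsum : Summable (fun j : ℤ => (x : ℤ → ℂ) (j + 1) * conj ((x : ℤ → ℂ) j)) := by
    refine Summable.of_norm_bounded (hs.summable.add hs1.summable) fun j => ?_
    rw [norm_mul, RCLike.norm_conj]
    nlinarith [sq_nonneg (‖(x : ℤ → ℂ) (j + 1)‖ - ‖(x : ℤ → ℂ) j‖),
      sq_nonneg (‖(x : ℤ → ℂ) (j + 1)‖), sq_nonneg (‖(x : ℤ → ℂ) j‖)]
  have hin := lp.hasSum_inner (𝕜 := ℂ) x (A x)
  have hin' : HasSum (fun j : ℤ => (x : ℤ → ℂ) (j + 1) * conj ((x : ℤ → ℂ) j)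
      + b (j - 1) * (x : ℤ → ℂ) (j - 1) * conj ((x : ℤ → ℂ) j)) (inner ℂ x (A x)) := by
    refine (congrArg (fun g => HasSum g (inner ℂ x (A x))) (funext fun j => ?_)).mpr hin
    rw [hA x j]
    simp only [RCLike.inner_apply]
    ring
  have hp := hsum.hasSum
  have hq := hin'.sub hp
  simp only [add_sub_cancel_left] at hq
  have hq' := (Equiv.addRight (1:ℤ)).hasSum_iff.mpr hq
  have htot := Complex.hasSum_re ((hp.add hq').mul_left w)
  rw [add_sub_cancel] at htot
  have hbd := ((hs.add hs1).mul_left (c / 2))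
  have := hasSum_le (fun j => ?_) htot hbd
  · linarith
  · simp only [Function.comp, Equiv.coe_addRight, add_sub_cancel_right]
    set p := (x : ℤ → ℂ) (j + 1)
    set q := (x : ℤ → ℂ) j
    have e : (w * (p * conj q + b j * q * conj p)).re = ((w + conj (w * b j)) * (p * conj q)).re := by
      simp [Complex.mul_re, Complex.mul_im]
      ring
    rw [e]
    have h1 := Complex.re_le_norm ((w + conj (w * b j)) * (p * conj q))
    rw [norm_mul, norm_mul, RCLike.norm_conj] at h1
    have h2 := hc j
    have h3 : 0 ≤ c := (norm_nonneg _).trans h2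
    have h4 : ‖w + conj (w * b j)‖ * (‖p‖ * ‖q‖) ≤ c * (‖p‖ * ‖q‖) := by gcongr
    nlinarith [mul_nonneg h3 (sq_nonneg (‖p‖ - ‖q‖))]

lemma numRange_subset (𝒜 : Finset ℂ) (b : ℤ → ℂ) (hb : ∀ i, b i ∈ 𝒜)
    (A : Hseq →L[ℂ] Hseq) (hA : IsTridiag b A) :
    closure (numRange A) ⊆ convexHull ℝ (⋃ a ∈ 𝒜, curve a) := by
  have hcl : IsClosed (convexHull ℝ (⋃ a ∈ 𝒜, curve a)) :=
    (isCompact_hull_biUnion curve isCompact_hull_curve 𝒜).isClosed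
  refine closure_minimal ?_ hcl
  rintro z ⟨x, hx, rfl⟩
  by_contra hz
  obtain ⟨f, u, h1, h2⟩ := geometric_hahn_banach_closed_point (convex_convexHull ℝ _) hcl hz
  obtain ⟨w, hw⟩ := dual_eq f
  have := re_inner_le hA w u (fun j => norm_le_of_curve w (b j) u fun z hz => by
    rw [← hw]
    exact (h1 z (subset_convexHull ℝ _ (Set.mem_biUnion (hb j) hz))).le) x
  rw [hx, ← hw] at this
  linarith

lemma spectrum_subset (a : ℂ) (A : Hseq →L[ℂ] Hseq) (hA : IsTridiag (fun _ => a) A) :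
    spectrum ℂ A ⊆ convexHull ℝ (curve a) := by
  intro z hz
  by_contra hn
  apply hz
  obtain ⟨f, u, h1, h2⟩ := geometric_hahn_banach_closed_point (convex_convexHull ℝ _)
    (isCompact_hull_curve a).isClosed hn
  obtain ⟨w, hw⟩ := dual_eq f
  have key := re_inner_le hA w u (fun j => norm_le_of_curve w a u fun z hz => by
    rw [← hw]
    exact (h1 z (subset_convexHull ℝ _ hz)).le)
  rw [hw] at h2
  have hc : 0 < ((w * z).re - u) / (‖w‖ + 1) := by
    have := norm_nonneg w
    apply div_pos <;> linarith
  refine ContinuousLinearMap.isUnit_of_forall_le_norm_inner_map _ (c := ⟨_, hc.le⟩) hc fun x => ?_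
  rw [norm_inner_symm]
  have e : (w * inner ℂ x ((algebraMap ℂ (Hseq →L[ℂ] Hseq) z - A) x)).re
      = (w * z).re * ‖x‖ ^ 2 - (w * inner ℂ x (A x)).re := by
    rw [sub_apply, inner_sub_right, Algebra.algebraMap_eq_smul_one, smul_apply,
      one_apply_eq_self, inner_smul_right, inner_self_eq_norm_sq_to_K, mul_sub, Complex.sub_re, ← mul_assoc]
    norm_cast
    congr 1
    exact Complex.re_mul_ofReal _ _
  have h3 := (Complex.re_le_norm _).trans (norm_mul_le w (inner ℂ x ((algebraMap ℂ (Hseq →L[ℂ] Hseq) z - A) x)))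
  rw [e] at h3
  have h4 := key x
  change ‖x‖ ^ 2 * (((w * z).re - u) / (‖w‖ + 1)) ≤ _
  rw [← mul_div_assoc, div_le_iff₀ (by positivity)]
  nlinarith [norm_nonneg (inner ℂ x ((algebraMap ℂ (Hseq →L[ℂ] Hseq) z - A) x))]

lemma tridiag_single {b : ℤ → ℂ} {A : Hseq →L[ℂ] Hseq} (hA : IsTridiag b A) (k : ℤ) (v : ℂ) :
    A (lp.single 2 k v) = lp.single 2 (k - 1) v + b k • lp.single 2 (k + 1) v := by
  ext j
  rw [hA]
  simp only [lp.coeFn_add, lp.coeFn_smul, Pi.add_apply, Pi.smul_apply, lp.coeFn_single,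
    Pi.single_apply, smul_eq_mul]
  congr 1
  · by_cases h : j + 1 = k
    · simp [h, eq_sub_of_add_eq h]
    · have : ¬ j = k - 1 := by omega
      simp [h, this]
  · by_cases h : j - 1 = k
    · have : j = k + 1 := by omega
      simp [h, this]
    · have : ¬ j = k + 1 := by omega
      simp [h, this]

lemma exists_block {b : ℤ → ℂ} {A : Hseq →L[ℂ] Hseq} (hA : IsTridiag b A) (a t : ℂ)
    (ht : ‖t‖ = 1) (m : ℤ) (n : ℕ) (hbl : ∀ k : ℕ, k < n → b (k + m) = a) :
    ∃ x : Hseq, ‖x‖ ^ 2 = n ∧ ‖A x - symb a t • x‖ ≤ 2 + 2 * ‖a‖ := by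
  have ht0 : t ≠ 0 := by rintro rfl; simp at ht
  have hct : conj t * t = 1 := by
    rw [mul_comm, Complex.mul_conj, Complex.normSq_eq_norm_sq, ht]; simp
  let u : ℤ → Hseq := fun k => lp.single 2 (k + m) (t ^ k)
  have hu : ∀ k, ‖u k‖ = 1 := by
    intro k
    simp [u, lp.norm_single, ht]
  have hAu : ∀ k : ℕ, k < n → A (u k) - symb a t • u k
      = (t • u ((k:ℤ) - 1) - t • u k) + ((a * conj t) • u ((k + 1 : ℕ) : ℤ) - (a * conj t) • u k) := by
    intro k hk
    have e1 : t • u ((k:ℤ) - 1) = lp.single 2 ((k:ℤ) + m - 1) (t ^ (k:ℤ)) := by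
      simp only [u]
      rw [← lp.single_smul, smul_eq_mul, zpow_sub_one₀ ht0, mul_comm, mul_assoc, inv_mul_cancel₀ ht0,
        mul_one]
      congr 1; ring
    have e2 : (a * conj t) • u ((k + 1 : ℕ) : ℤ) = a • lp.single 2 ((k:ℤ) + m + 1) (t ^ (k:ℤ)) := by
      simp only [u]
      rw [← lp.single_smul, ← lp.single_smul, smul_eq_mul, smul_eq_mul]
      push_cast
      rw [zpow_add_one₀ ht0]
      have : a * conj t * (t ^ (k:ℤ) * t) = a * t ^ (k:ℤ) := by
        linear_combination (a * t ^ (k:ℤ)) * hct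
      rw [this]
      congr 1; ring
    rw [e1, e2]
    have := tridiag_single hA (k + m) (t ^ (k:ℤ))
    rw [hbl k hk] at this
    rw [show A (u k) = _ from this, symb, add_smul]
    abel
  refine ⟨∑ k ∈ Finset.range n, u k, ?_, ?_⟩
  · have h := lp.norm_sum_single (p := 2) (E := fun _ : ℤ => ℂ) (by norm_num)
      (fun i => t ^ (i - m)) ((Finset.range n).map ⟨fun k : ℕ => (k:ℤ) + m, fun x y h => by simpa using h⟩)
    rw [Finset.sum_map, Finset.sum_map] at h
    have e : ∀ k ∈ Finset.range n, u k = lp.single 2 ((k:ℤ) + m) (t ^ ((k:ℤ) + m - m)) := by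
      intro k _
      rw [add_sub_cancel_right]
    rw [Finset.sum_congr rfl e]
    have h' : ‖∑ k ∈ Finset.range n, (lp.single 2 ((k:ℤ) + m) (t ^ ((k:ℤ) + m - m)) : Hseq)‖
        ^ (2 : ℝ≥0∞).toReal
        = ∑ k ∈ Finset.range n, ‖t ^ ((k:ℤ) + m - m)‖ ^ (2 : ℝ≥0∞).toReal := h
    simp only [norm_zpow, ht, one_zpow, one_pow, Finset.sum_const, Finset.card_range,
      nsmul_eq_mul, mul_one, ENNReal.toReal_ofNat, Real.rpow_ofNat] at h'
    exact h'
  · have : A (∑ k ∈ Finset.range n, u k) - symb a t • ∑ k ∈ Finset.range n, u k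
        = (t • u (-1) - t • u ((n:ℤ) - 1)) + ((a * conj t) • u n - (a * conj t) • u 0) := by
      rw [map_sum, Finset.smul_sum, ← Finset.sum_sub_distrib,
        Finset.sum_congr rfl (fun k hk => hAu k (Finset.mem_range.mp hk)), Finset.sum_add_distrib]
      congr 1
      · have := Finset.sum_range_sub' (fun k : ℕ => t • u ((k:ℤ) - 1)) n
        simpa using this
      · have := Finset.sum_range_sub (fun k : ℕ => (a * conj t) • u (k:ℤ)) n
        simpa using this
    rw [this]
    refine (norm_add_le _ _).trans ?_
    refine (add_le_add (norm_sub_le _ _) (norm_sub_le _ _)).trans ?_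
    simp only [norm_smul, hu, norm_mul, RCLike.norm_conj, ht]
    linarith

lemma curve_subset_spectrum (a : ℂ) (A : Hseq →L[ℂ] Hseq) (hA : IsTridiag (fun _ => a) A) :
    curve a ⊆ spectrum ℂ A := by
  rintro _ ⟨t, ht, rfl⟩
  have ht' : ‖t‖ = 1 := by simpa using ht
  by_contra hn
  rw [spectrum.notMem_iff] at hn
  obtain ⟨B, hB⟩ := hn
  obtain ⟨n, hn⟩ := exists_nat_gt ((‖(↑B⁻¹ : Hseq →L[ℂ] Hseq)‖ * (2 + 2 * ‖a‖)) ^ 2)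
  obtain ⟨x, hx, hx2⟩ := exists_block hA a t ht' 0 n (fun _ _ => rfl)
  have h1 : (↑B⁻¹ : Hseq →L[ℂ] Hseq) ((B : Hseq →L[ℂ] Hseq) x) = x := by
    have : ((↑B⁻¹ : Hseq →L[ℂ] Hseq) * (B : Hseq →L[ℂ] Hseq)) x = x := by
      rw [Units.inv_mul]; rfl
    exact this
  have h2 : (B : Hseq →L[ℂ] Hseq) x = - (A x - symb a t • x) := by
    rw [hB, sub_apply, Algebra.algebraMap_eq_smul_one, smul_apply, one_apply_eq_self]
    abel
  have h3 := (↑B⁻¹ : Hseq →L[ℂ] Hseq).le_opNorm ((B : Hseq →L[ℂ] Hseq) x)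
  rw [h1, h2, norm_neg] at h3
  have h4 : ‖x‖ ≤ ‖(↑B⁻¹ : Hseq →L[ℂ] Hseq)‖ * (2 + 2 * ‖a‖) := h3.trans (by gcongr)
  have h5 := pow_le_pow_left₀ (norm_nonneg x) h4 2
  linarith

lemma exists_const_block (𝒜 : Finset ℂ) (b : ℤ → ℂ) (hb : ∀ i, b i ∈ 𝒜) (a : ℂ)
    (h : (fun _ : ℤ => a) ∈ closure (shiftOrbit b)) (n : ℕ) :
    ∃ m : ℤ, ∀ k : ℕ, k < n → b (k + m) = a := by
  classical
  have hU : IsOpen (((𝒜.erase a : Finset ℂ) : Set ℂ)ᶜ) :=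
    (Finset.finite_toSet _).isClosed.isOpen_compl
  have hO : IsOpen (Set.pi (((Finset.range n).image (fun k : ℕ => (k:ℤ)) : Finset ℤ) : Set ℤ)
      (fun _ => ((𝒜.erase a : Finset ℂ) : Set ℂ)ᶜ)) :=
    isOpen_set_pi (Finset.finite_toSet _) fun _ _ => hU
  obtain ⟨c, hc, m, rfl⟩ := mem_closure_iff.mp h _ hO (by intro i _; simp)
  refine ⟨m, fun k hk => ?_⟩
  have := hc k (by simpa using hk)
  simp only [Set.mem_compl_iff, Finset.mem_coe, Finset.mem_erase, not_and] at this
  by_contra hne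
  exact this hne (hb _)

lemma curve_subset_numRange (b : ℤ → ℂ) (a : ℂ) (A : Hseq →L[ℂ] Hseq) (hA : IsTridiag b A)
    (h : ∀ n : ℕ, ∃ m : ℤ, ∀ k : ℕ, k < n → b (k + m) = a) :
    curve a ⊆ closure (numRange A) := by
  rintro _ ⟨t, ht, rfl⟩
  have ht' : ‖t‖ = 1 := by simpa using ht
  rw [Metric.mem_closure_iff]
  intro ε hε
  obtain ⟨n, hn⟩ := exists_nat_gt (((2 + 2 * ‖a‖) / ε) ^ 2)
  obtain ⟨m, hm⟩ := h n
  obtain ⟨x, hx, hx2⟩ := exists_block hA a t ht' m n hm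
  have hxε : (2 + 2 * ‖a‖) / ε < ‖x‖ := by
    rw [← hx] at hn
    exact lt_of_pow_lt_pow_left₀ 2 (norm_nonneg _) hn
  have hx0 : 0 < ‖x‖ := lt_of_le_of_lt (by positivity) hxε
  set y : Hseq := ((‖x‖⁻¹ : ℝ) : ℂ) • x with hy
  have hy1 : ‖y‖ = 1 := by
    rw [hy, norm_smul, Complex.norm_real, norm_inv, norm_norm, inv_mul_cancel₀ hx0.ne']
  refine ⟨_, ⟨y, hy1, rfl⟩, ?_⟩
  have e : inner ℂ y (A y) - symb a t = inner ℂ y (A y - symb a t • y) := by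
    rw [inner_sub_right, inner_smul_right, inner_self_eq_norm_sq_to_K, hy1]
    simp
  rw [dist_comm, dist_eq_norm, e]
  refine (norm_inner_le_norm _ _).trans_lt ?_
  have e2 : A y - symb a t • y = ((‖x‖⁻¹ : ℝ) : ℂ) • (A x - symb a t • x) := by
    rw [hy, map_smul, smul_sub, smul_comm]
  rw [hy1, one_mul, e2, norm_smul, Complex.norm_real, norm_inv, norm_norm, inv_mul_lt_iff₀ hx0]
  rw [div_lt_iff₀ hε] at hxε
  linarith

lemma exists_phase (c d : ℂ) : ∃ ω : ℂ, ‖ω‖ = 1 ∧ (ω * c + conj ω * d).im = 0 := by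
  have key : ∀ ω : ℂ, (ω * c + conj ω * d).im = (ω * (c - conj d)).im := by
    intro ω
    simp [Complex.mul_im]
    ring
  by_cases h : c - conj d = 0
  · exact ⟨1, by simp, by rw [key, h]; simp⟩
  · have h1 : ‖c - conj d‖ ≠ 0 := norm_ne_zero_iff.mpr h
    refine ⟨conj (c - conj d) / ‖c - conj d‖, ?_, ?_⟩
    · rw [norm_div, RCLike.norm_conj, Complex.norm_real, norm_norm, div_self h1]
    · rw [key, div_mul_eq_mul_div, mul_comm, Complex.mul_conj, ← Complex.ofReal_div,
        Complex.ofReal_im]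

lemma th_aux (T : Hseq →L[ℂ] Hseq) (x y : Hseq) (hx : ‖x‖ = 1) (hy : ‖y‖ = 1)
    (hTx : inner ℂ x (T x) = 0) (hTy : inner ℂ y (T y) = 1) (s : ℝ) (hs0 : 0 ≤ s) (hs1 : s ≤ 1) :
    ∃ z : Hseq, ‖z‖ = 1 ∧ inner ℂ z (T z) = (s : ℂ) := by
  obtain ⟨ω, hω, him⟩ := exists_phase (inner ℂ x (T y)) (inner ℂ y (T x))
  have hωω : conj ω * ω = 1 := by
    rw [mul_comm, Complex.mul_conj, Complex.normSq_eq_norm_sq, hω]; simp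
  let z : ℝ → Hseq := fun r => ((1 - r : ℝ) : ℂ) • x + ((r : ℝ) : ℂ) • (ω • y)
  have hz : Continuous z := by
    have h1 : Continuous fun r : ℝ => ((1 - r : ℝ) : ℂ) := by fun_prop
    exact (h1.smul continuous_const).add (Complex.continuous_ofReal.smul continuous_const)
  have hQ : ∀ r, (inner ℂ (z r) (T (z r))).im = 0 := by
    intro r
    have : inner ℂ (z r) (T (z r)) = ((r ^ 2 : ℝ) : ℂ) + (((1 - r) * r : ℝ) : ℂ)
        * (ω * inner ℂ x (T y) + conj ω * inner ℂ y (T x)) := by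
      simp only [z, map_add, map_smul, inner_add_left, inner_add_right, inner_smul_left,
        inner_smul_right, hTx, hTy, Complex.conj_ofReal]
      push_cast
      linear_combination (r:ℂ) ^ 2 * hωω
    rw [this, Complex.add_im, Complex.ofReal_im, Complex.im_ofReal_mul, him]
    simp
  let F : ℝ → ℝ := fun r => (inner ℂ (z r) (T (z r))).re - s * ‖z r‖ ^ 2
  have hF : Continuous F := by
    have h2 : Continuous fun r => (inner ℂ (z r) (T (z r)) : ℂ) :=
      hz.inner (T.continuous.comp hz)
    exact (Complex.continuous_re.comp h2).sub (continuous_const.mul (hz.norm.pow 2))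
  have hF0 : F 0 ≤ 0 := by
    have e : z 0 = x := by
      simp only [z, sub_zero, Complex.ofReal_one, Complex.ofReal_zero]
      rw [one_smul, zero_smul, add_zero]
    simp only [F, e, hTx, hx]
    simp [hs0]
  have hF1 : 0 ≤ F 1 := by
    have : inner ℂ (ω • y) (T (ω • y)) = 1 := by
      rw [map_smul, inner_smul_left, inner_smul_right, hTy, mul_one, hωω]
    have e : z 1 = ω • y := by
      simp only [z, sub_self, Complex.ofReal_one, Complex.ofReal_zero]
      rw [one_smul, zero_smul, zero_add]
    simp only [F, e, this, norm_smul, hω, hy]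
    simp [hs1]
  obtain ⟨r, -, hr⟩ := intermediate_value_Icc (zero_le_one) hF.continuousOn ⟨hF0, hF1⟩
  have hz0 : z r ≠ 0 := by
    intro h
    have h1 : ((1 - r : ℝ) : ℂ) • x = (-((r : ℝ) : ℂ) * ω) • y := by
      have := eq_neg_of_add_eq_zero_left h
      rw [this, smul_smul, ← neg_smul, neg_mul]
    have h2 : inner ℂ (((1 - r : ℝ) : ℂ) • x) (T (((1 - r : ℝ) : ℂ) • x)) = 0 := by
      rw [map_smul, inner_smul_left, inner_smul_right, hTx]; simp
    rw [h1, map_smul, inner_smul_left, inner_smul_right, hTy] at h2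
    have h3 : r = 0 := by
      have hω0 : ω ≠ 0 := by rintro rfl; simp at hω
      simpa [hω0] using h2
    rw [h3] at h1
    have : x = 0 := by simpa using h1
    rw [this] at hx
    simp at hx
  have hzn : 0 < ‖z r‖ := norm_pos_iff.mpr hz0
  have hval : inner ℂ (z r) (T (z r)) = ((s * ‖z r‖ ^ 2 : ℝ) : ℂ) := by
    apply Complex.ext
    · rw [Complex.ofReal_re]; simp only [F] at hr; linarith
    · rw [hQ, Complex.ofReal_im]
  refine ⟨((‖z r‖⁻¹ : ℝ) : ℂ) • z r, ?_, ?_⟩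
  · rw [norm_smul, Complex.norm_real, norm_inv, norm_norm, inv_mul_cancel₀ hzn.ne']
  · rw [map_smul, inner_smul_left, inner_smul_right, hval, Complex.conj_ofReal]
    norm_cast
    field_simp

/-- Toeplitz–Hausdorff. -/
lemma convex_numRange (A : Hseq →L[ℂ] Hseq) : Convex ℝ (numRange A) := by
  rintro p ⟨x, hx, hp⟩ q ⟨y, hy, hq⟩ α β hα hβ hαβ
  by_cases hpq : q = p
  · rw [hpq, ← add_smul, hαβ, one_smul]
    exact ⟨x, hx, hp⟩
  have hne : q - p ≠ 0 := sub_ne_zero.mpr hpq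
  have hT : ∀ v : Hseq, ‖v‖ = 1 → inner ℂ v (((q - p)⁻¹ • (A - p • (1 : Hseq →L[ℂ] Hseq))) v)
      = (q - p)⁻¹ * (inner ℂ v (A v) - p) := by
    intro v hv
    rw [smul_apply, sub_apply, smul_apply, one_apply_eq_self, inner_smul_right, inner_sub_right,
      inner_smul_right, inner_self_eq_norm_sq_to_K, hv]
    simp
  obtain ⟨z, hz, hzz⟩ := th_aux ((q - p)⁻¹ • (A - p • (1 : Hseq →L[ℂ] Hseq))) x y hx hy
    (by rw [hT x hx, hp]; simp) (by rw [hT y hy, hq]; field_simp) β hβ (by linarith)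
  refine ⟨z, hz, ?_⟩
  rw [hT z hz, inv_mul_eq_iff_eq_mul₀ hne] at hzz
  have hα' : (α : ℂ) = 1 - β := by
    rw [← Complex.ofReal_one, ← hαβ]; push_cast; ring
  rw [Complex.real_smul, Complex.real_smul, hα']
  linear_combination hzz

/-- If every constant sequence `𝔞`, `𝔞 ∈ 𝒜`, belongs to `X_b`, then
`closure (W(A_b)) = conv (⋃_{𝔞∈𝒜} closure (W(A_𝔞))) = conv (⋃_{𝔞∈𝒜} σ(A_𝔞))`,
where `A 𝔞` is the Laurent operator of the constant sequence `𝔞`. -/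
theorem stmt14 (𝒜 : Finset ℂ) (b : ℤ → ℂ) (hb : ∀ i, b i ∈ 𝒜)
    (hconst : ∀ a ∈ 𝒜, (fun _ : ℤ => a) ∈ closure (shiftOrbit b))
    (Ab : Hseq →L[ℂ] Hseq) (hAb : IsTridiag b Ab)
    (A : ℂ → Hseq →L[ℂ] Hseq) (hA : ∀ a ∈ 𝒜, IsTridiag (fun _ => a) (A a)) :
    closure (numRange Ab) = convexHull ℝ (⋃ a ∈ 𝒜, closure (numRange (A a))) ∧
      closure (numRange Ab) = convexHull ℝ (⋃ a ∈ 𝒜, spectrum ℂ (A a)) := by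
  have hsing : ∀ a : ℂ, (⋃ c ∈ ({a} : Finset ℂ), curve c) = curve a := by intro a; simp
  have h1 : closure (numRange Ab) = convexHull ℝ (⋃ a ∈ 𝒜, curve a) := by
    refine (numRange_subset 𝒜 b hb Ab hAb).antisymm ?_
    refine convexHull_min ?_ (convex_numRange Ab).closure
    refine Set.iUnion₂_subset fun a ha => ?_
    exact curve_subset_numRange b a Ab hAb (exists_const_block 𝒜 b hb a (hconst a ha))
  rw [h1]
  constructor
  · apply Set.Subset.antisymm
    · refine convexHull_mono (Set.iUnion₂_mono fun a ha => ?_)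
      exact curve_subset_numRange _ a (A a) (hA a ha) fun n => ⟨0, fun _ _ => rfl⟩
    · refine convexHull_min (Set.iUnion₂_subset fun a ha => ?_) (convex_convexHull ℝ _)
      have := numRange_subset {a} (fun _ => a) (by simp) (A a) (hA a ha)
      rw [hsing] at this
      exact this.trans (convexHull_mono (Set.subset_biUnion_of_mem (u := curve) ha))
  · apply Set.Subset.antisymm
    · exact convexHull_mono (Set.iUnion₂_mono fun a ha => curve_subset_spectrum a (A a) (hA a ha))
    · refine convexHull_min (Set.iUnion₂_subset fun a ha => ?_) (convex_convexHull ℝ _)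
      exact (spectrum_subset a (A a) (hA a ha)).trans
        (convexHull_mono (Set.subset_biUnion_of_mem (u := curve) ha))
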